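/- arXiv:2511.05117 — 7 statements merged into one kernel-verified Lean document; each statement's English description precedes it below -/
import Mathlib

section
/- Let A be an associative unital ring and let D, L ∈ A. Write ad(D)(Z) = DZ − ZD, L^(t) = ad(D)^t(L), and for a tuple (t_1,…,t_m) of nonnegative integers write L^(t_1,…,t_m) = L^(t_1)·L^(t_2)⋯L^(t_m). Then for every integer k ≥ 1 one has the identity (D+L)^k = D^k + Σ_{i=1}^{k} Σ_{j=0}^{i−1} T_{i,j,k} D^{k−i}, where T_{i,j,k} = C(k,i) · Σ g(t_1,…,t_m) L^(t_1,…,t_m), the inner sum running over all tuples (t_1,…,t_m) of nonnegative integers with m = i − j and t_1 + ⋯ + t_m = j, C(k,i) the binomial coefficient, and g the integer-valued function defined in the context. -/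
/-- `adIter D L t = (ad D)^t (L)`, where `ad D Z = D*Z - Z*D`; i.e. `L^(t)`. -/
def adIter {A : Type*} [Ring A] (D L : A) : ℕ → A
  | 0 => L
  | t + 1 => D * adIter D L t - adIter D L t * D

theorem List.sum_set_getD_lt (l : List ℕ) (r : ℕ) (h : l.getD r 0 ≠ 0) :
    (l.set r (l.getD r 0 - 1)).sum < l.sum := by
  induction l generalizing r with
  | nil => simp at h
  | cons a l ih =>
    cases r with
    | zero =>
      simp only [List.getD_cons_zero] at h
      simp only [List.set, List.getD_cons_zero, List.sum_cons]
      omega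
    | succ r =>
      simp only [List.getD_cons_succ] at h
      simp only [List.set, List.getD_cons_succ, List.sum_cons]
      exact Nat.add_lt_add_left (ih r h) a

/-- The integer-valued function `g` on tuples of nonnegative integers, defined by the
recursion of the combinatorial lemma:
`g(t₁) = 1`; for `m > 1` and `t₁ = 0`:
`g(0,t₂,…,t_m) = g(t₂,…,t_m) + Σ_{r=2}^m g(0,t₂,…,t_r−1,…,t_m)`;
for `m > 1` and `t₁ ≥ 1`: `g(t₁,…,t_m) = Σ_{r=1}^m g(t₁,…,t_r−1,…,t_m)`;
where a tuple containing a negative entry contributes `0` (encoded here by the guard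
`if (t₂ :: ls).getD r 0 = 0 then 0 else …`, since the entries are natural numbers). -/
def gfun : List ℕ → ℤ
  | [] => 1
  | [_] => 1
  | t₁ :: t₂ :: ls =>
      (if _h : t₁ = 0 then gfun (t₂ :: ls) else gfun ((t₁ - 1) :: t₂ :: ls)) +
      ∑ r ∈ Finset.range (ls.length + 1),
        if h2 : (t₂ :: ls).getD r 0 = 0 then 0
        else gfun (t₁ :: (t₂ :: ls).set r ((t₂ :: ls).getD r 0 - 1))
termination_by l => l.length + l.sum
decreasing_by
  · simp only [List.length_cons, List.sum_cons]; omega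
  · simp only [List.length_cons, List.sum_cons]; omega
  · have := List.sum_set_getD_lt (t₂ :: ls) r h2
    simp only [List.length_cons, List.sum_cons, List.length_set] at *
    omega

/-- `T_{i,j,k} = C(k,i) · Σ_{t₁+⋯+t_m = j, m = i − j} g(t₁,…,t_m) · L^(t₁)⋯L^(t_m)`. -/
def Tcoef {A : Type*} [Ring A] (D L : A) (i j k : ℕ) : A :=
  (k.choose i) •
    ∑ t ∈ Finset.Nat.antidiagonalTuple (i - j) j,
      gfun (List.ofFn t) • (List.ofFn fun r => adIter D L (t r)).prod

theorem List.getD_ofFn {α : Type*} {n : ℕ} (v : Fin n → α) (r : Fin n) (d : α) :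
    (List.ofFn v).getD r d = v r := by
  rw [List.getD_eq_getElem _ _ (by rw [List.length_ofFn]; exact r.2), List.getElem_ofFn]

theorem List.set_ofFn {α : Type*} {n : ℕ} (v : Fin n → α) (r : Fin n) (x : α) :
    (List.ofFn v).set r x = List.ofFn (Function.update v r x) := by
  apply List.ext_getElem
  · rw [List.length_set, List.length_ofFn, List.length_ofFn]
  · intro i h1 h2
    rw [List.getElem_set, List.getElem_ofFn, List.getElem_ofFn, Function.update_apply]
    simp only [Fin.ext_iff, eq_comm]

theorem gfun_cons_ofFn {m : ℕ} (a : ℕ) (v : Fin (m + 1) → ℕ) :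
    gfun (a :: List.ofFn v) =
      (if a = 0 then gfun (List.ofFn v) else gfun ((a - 1) :: List.ofFn v)) +
        ∑ r, if v r = 0 then 0 else gfun (a :: List.ofFn (Function.update v r (v r - 1))) := by
  have hv := List.ofFn_succ (f := v)
  have hlen : (List.ofFn fun i : Fin m => v i.succ).length + 1 = m + 1 := by
    rw [List.length_ofFn]
  rw [hv, gfun, hlen, ← hv, Finset.sum_range]
  simp only [List.getD_ofFn, List.set_ofFn, dite_eq_ite]

theorem gfun_ofFn_succ {m : ℕ} (t : Fin (m + 1) → ℕ) :
    gfun (List.ofFn t) = (if t 0 = 0 then gfun (List.ofFn fun r : Fin m => t r.succ) else 0) +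
      ∑ r, if t r = 0 then 0 else gfun (List.ofFn (Function.update t r (t r - 1))) := by
  cases m with
  | zero => by_cases h0 : t 0 = 0 <;> simp [gfun, h0]
  | succ m =>
    have hsucc (r s : Fin (m + 1)) : Function.update t r.succ (t r.succ - 1) s.succ =
        Function.update (fun i : Fin (m + 1) => t i.succ) r (t r.succ - 1) s := by
      simp only [Function.update_apply, Fin.succ_inj]
    have hzero (r : Fin (m + 1)) : Function.update t r.succ (t r.succ - 1) 0 = t 0 := by
      rw [Function.update_of_ne (Fin.succ_ne_zero r).symm]
    have hzero' (s : Fin (m + 1)) : Function.update t 0 (t 0 - 1) s.succ = t s.succ := by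
      rw [Function.update_of_ne (Fin.succ_ne_zero s)]
    rw [Fin.sum_univ_succ, List.ofFn_succ, gfun_cons_ofFn, ← add_assoc]
    congr 1
    · rw [List.ofFn_succ (f := Function.update t 0 (t 0 - 1))]
      simp only [hzero', Function.update_self]
      split_ifs
      · exact (add_zero _).symm
      · exact (zero_add _).symm
    · refine Finset.sum_congr rfl fun r _ => ?_
      rw [List.ofFn_succ (f := Function.update t r.succ (t r.succ - 1))]
      simp only [hsucc, hzero]

theorem commutator_prod_ofFn_adIter {A : Type*} [Ring A] (D L : A) {m : ℕ} (t : Fin m → ℕ) :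
    D * (List.ofFn fun r => adIter D L (t r)).prod -
        (List.ofFn fun r => adIter D L (t r)).prod * D =
      ∑ r, (List.ofFn fun s => adIter D L (Function.update t r (t r + 1) s)).prod := by
  induction m with
  | zero => simp
  | succ m ih =>
    have hsucc (r : Fin m) (s : Fin m) : Function.update t r.succ (t r.succ + 1) s.succ =
        Function.update (fun i : Fin m => t i.succ) r (t r.succ + 1) s := by
      simp [Function.update]
    have hzero (r : Fin m) : Function.update t r.succ (t r.succ + 1) 0 = t 0 := by
      simp [Function.update, Fin.ext_iff]
    have hzero' (s : Fin m) : Function.update t 0 (t 0 + 1) s.succ = t s.succ := by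
      simp [Function.update]
    rw [Fin.sum_univ_succ]
    simp only [List.ofFn_succ, List.prod_cons, hsucc, hzero, hzero', Function.update_self]
    rw [← Finset.mul_sum, ← ih, adIter]
    noncomm_ring

namespace Finset.Nat

theorem sum_antidiagonalTuple_succ_ite {M : Type*} [AddCommMonoid M] (m j : ℕ)
    (f : (Fin m → ℕ) → M) :
    ∑ t ∈ antidiagonalTuple (m + 1) j, (if t 0 = 0 then f fun r => t r.succ else 0) =
      ∑ t ∈ antidiagonalTuple m j, f t := by
  rw [← sum_filter]
  refine sum_nbij' (fun t r => t r.succ) (fun t => Fin.cons 0 t) ?_ ?_ ?_ ?_ ?_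
  · simp only [mem_filter, mem_antidiagonalTuple, Fin.sum_univ_succ]
    rintro t ⟨h, h0⟩
    simpa [h0] using h
  · simp [mem_antidiagonalTuple, Fin.sum_univ_succ]
  · simp only [mem_filter]
    rintro t ⟨-, h0⟩
    funext r
    cases r using Fin.cases <;> simp [h0]
  · simp
  · simp

theorem sum_antidiagonalTuple_update_pred {M : Type*} [AddCommMonoid M] {m : ℕ} (j : ℕ)
    (r : Fin m) (f : (Fin m → ℕ) → (Fin m → ℕ) → M) :
    ∑ t ∈ antidiagonalTuple m (j + 1),
        (if t r = 0 then 0 else f (Function.update t r (t r - 1)) t) =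
      ∑ t ∈ antidiagonalTuple m j, f t (Function.update t r (t r + 1)) := by
  simp only [← ite_not (_ = 0)]
  rw [← sum_filter]
  have key (t : Fin m → ℕ) (h : t r ≠ 0) :
      Function.update (Function.update t r (t r - 1)) r (t r - 1 + 1) = t := by
    rw [Function.update_idem, Nat.sub_add_cancel (Nat.pos_of_ne_zero h), Function.update_eq_self]
  refine sum_nbij' (fun t => Function.update t r (t r - 1))
    (fun t => Function.update t r (t r + 1)) ?_ ?_ ?_ ?_ ?_
  · simp only [mem_filter, mem_antidiagonalTuple]
    rintro t ⟨h, h0⟩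
    rw [sum_update_of_mem (mem_univ r)]
    rw [sum_eq_add_sum_sdiff_singleton_of_mem (mem_univ r)] at h
    omega
  · simp only [mem_filter, mem_antidiagonalTuple]
    rintro t h
    rw [sum_update_of_mem (mem_univ r)]
    rw [sum_eq_add_sum_sdiff_singleton_of_mem (mem_univ r)] at h
    simp
    omega
  · simp only [mem_filter]
    rintro t ⟨-, h0⟩
    simpa using key t h0
  · simp
  · simp only [mem_filter]
    rintro t ⟨-, h0⟩
    simp [Nat.sub_add_cancel (Nat.pos_of_ne_zero h0)]

end Finset.Nat

/-- The weighted sum of the products `L^(t₁)⋯L^(t_m)` over the tuples of length `m` and sum `j`. -/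
def gSum {A : Type*} [Ring A] (D L : A) (m j : ℕ) : A :=
  ∑ t ∈ Finset.Nat.antidiagonalTuple m j,
    gfun (List.ofFn t) • (List.ofFn fun r => adIter D L (t r)).prod

section gSum

variable {A : Type*} [Ring A] (D L : A)

theorem gSum_zero_zero : gSum D L 0 0 = 1 := by
  simp [gSum, gfun]

theorem gSum_zero_succ (j : ℕ) : gSum D L 0 (j + 1) = 0 := by
  simp [gSum]

theorem gSum_succ_eq_add (m j : ℕ) :
    gSum D L (m + 1) j = L * gSum D L m j +
      ∑ r, ∑ t ∈ Finset.Nat.antidiagonalTuple (m + 1) j,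
        if t r = 0 then 0 else gfun (List.ofFn (Function.update t r (t r - 1))) •
          (List.ofFn fun s => adIter D L (t s)).prod := by
  rw [Finset.sum_comm, gSum, gSum, Finset.mul_sum,
    ← Finset.Nat.sum_antidiagonalTuple_succ_ite m j fun t =>
      L * gfun (List.ofFn t) • (List.ofFn fun r => adIter D L (t r)).prod,
    ← Finset.sum_add_distrib]
  refine Finset.sum_congr rfl fun t _ => ?_
  rw [gfun_ofFn_succ, add_smul, Finset.sum_smul]
  congr 1
  · split_ifs with h
    · rw [List.ofFn_succ (f := fun r => adIter D L (t r)), List.prod_cons, h, adIter, mul_smul_comm]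
    · simp
  · simp only [ite_smul, zero_smul]

theorem gSum_succ_zero (m : ℕ) : gSum D L (m + 1) 0 = L * gSum D L m 0 := by
  rw [gSum_succ_eq_add, add_eq_left]
  refine Finset.sum_eq_zero fun r _ => Finset.sum_eq_zero fun t ht => if_pos ?_
  rw [Finset.Nat.antidiagonalTuple_zero_right, Finset.mem_singleton] at ht
  rw [ht, Pi.zero_apply]

theorem gSum_succ_succ (m j : ℕ) :
    gSum D L (m + 1) (j + 1) = L * gSum D L m (j + 1) +
      (D * gSum D L (m + 1) j - gSum D L (m + 1) j * D) := by
  rw [gSum_succ_eq_add]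
  congr 1
  simp only [Finset.Nat.sum_antidiagonalTuple_update_pred j _ fun u t =>
    gfun (List.ofFn u) • (List.ofFn fun s => adIter D L (t s)).prod]
  rw [Finset.sum_comm, gSum, Finset.mul_sum, Finset.sum_mul, ← Finset.sum_sub_distrib]
  refine Finset.sum_congr rfl fun t _ => ?_
  rw [← Finset.smul_sum, ← commutator_prod_ofFn_adIter, smul_sub, mul_smul_comm, smul_mul_assoc]

theorem sum_gSum_antidiagonal_succ (i : ℕ) :
    ∑ p ∈ Finset.HasAntidiagonal.antidiagonal (i + 1), gSum D L p.1 p.2 =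
      (D * ∑ p ∈ Finset.HasAntidiagonal.antidiagonal i, gSum D L p.1 p.2 -
        (∑ p ∈ Finset.HasAntidiagonal.antidiagonal i, gSum D L p.1 p.2) * D) +
      L * ∑ p ∈ Finset.HasAntidiagonal.antidiagonal i, gSum D L p.1 p.2 := by
  have had : D * ∑ p ∈ Finset.HasAntidiagonal.antidiagonal i, gSum D L p.1 p.2 -
      (∑ p ∈ Finset.HasAntidiagonal.antidiagonal i, gSum D L p.1 p.2) * D =
      ∑ p ∈ Finset.HasAntidiagonal.antidiagonal i, (D * gSum D L p.1 p.2 - gSum D L p.1 p.2 * D) := by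
    rw [Finset.mul_sum, Finset.sum_mul, Finset.sum_sub_distrib]
  rw [had, Finset.mul_sum]
  cases i with
  | zero => simp [Finset.Nat.antidiagonal_succ, gSum_zero_zero, gSum_zero_succ, gSum_succ_zero]
  | succ i =>
    rw [Finset.Nat.sum_antidiagonal_succ, Finset.Nat.sum_antidiagonal_succ',
      Finset.Nat.sum_antidiagonal_succ (f := fun p => D * gSum D L p.1 p.2 - gSum D L p.1 p.2 * D),
      Finset.Nat.sum_antidiagonal_succ' (f := fun p => L * gSum D L p.1 p.2)]
    simp only [gSum_zero_succ, gSum_succ_succ, gSum_succ_zero, Finset.sum_add_distrib]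
    simp
    abel

theorem add_pow_eq_sum_gSum (k : ℕ) :
    (D + L) ^ k = ∑ i ∈ Finset.range (k + 1),
      k.choose i • ((∑ p ∈ Finset.HasAntidiagonal.antidiagonal i, gSum D L p.1 p.2) * D ^ (k - i)) := by
  let V := LinearMap.mulRight ℤ D
  let U := LinearMap.mulLeft ℤ D - V + LinearMap.mulLeft ℤ L
  have hU (i : ℕ) : (U ^ i) 1 = ∑ p ∈ Finset.HasAntidiagonal.antidiagonal i, gSum D L p.1 p.2 := by
    induction i with
    | zero => simp [gSum_zero_zero]
    | succ i ih => rw [pow_succ', Module.End.mul_apply, ih, sum_gSum_antidiagonal_succ]; rfl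
  have hcomm : Commute U V := by
    ext x
    simp [U, V, mul_assoc, sub_mul, add_mul]
  have hsum : LinearMap.mulLeft ℤ (D + L) = U + V := by
    ext x
    simp only [U, V, LinearMap.mulLeft_apply, LinearMap.add_apply, LinearMap.sub_apply,
      LinearMap.mulRight_apply]
    noncomm_ring
  have hpow : (LinearMap.mulLeft ℤ (D + L) ^ k) 1 = (D + L) ^ k := by
    simp [LinearMap.pow_mulLeft]
  rw [← hpow, hsum, hcomm.add_pow, LinearMap.sum_apply]
  refine Finset.sum_congr rfl fun i _ => ?_
  rw [(hcomm.pow_pow i (k - i)).eq, ← nsmul_eq_mul', LinearMap.smul_apply, Module.End.mul_apply, hU]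
  simp only [V, LinearMap.pow_mulRight, LinearMap.mulRight_apply]

end gSum

/-- Combinatorial Lemma: for `k ≥ 1`,
`(D+L)^k = D^k + Σ_{i=1}^{k} Σ_{j=0}^{i−1} T_{i,j,k} D^{k−i}`. -/
theorem combinatorial_lemma {A : Type*} [Ring A] (D L : A) (k : ℕ) (hk : 1 ≤ k) :
    (D + L) ^ k =
      D ^ k + ∑ i ∈ Finset.Icc 1 k, ∑ j ∈ Finset.range i,
        Tcoef D L i j k * D ^ (k - i) := by
  rw [add_pow_eq_sum_gSum, Finset.range_eq_Ico, Finset.sum_eq_sum_Ico_succ_bot k.succ_pos]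
  congr 1
  · simp [gSum_zero_zero]
  · refine Finset.sum_congr (by ext; simp) fun i hi => ?_
    obtain ⟨i, rfl⟩ : ∃ n, i = n + 1 := ⟨i - 1, by simp at hi; omega⟩
    rw [← Finset.sum_mul, ← smul_mul_assoc, ← Finset.Nat.sum_antidiagonal_swap,
      Finset.Nat.sum_antidiagonal_eq_sum_range_succ_mk, Finset.sum_range_succ, Prod.swap,
      Nat.sub_self, gSum_zero_succ, add_zero, Finset.smul_sum]
    rfl
end

section
/- Let A be an associative unital ring and let D, L ∈ A, with L^(t) = ad(D)^t(L). Then for every integer k ≥ 1 the element (D+L)^k can be written in the standard form (D+L)^k = D^k + Σ c_{k;t_1,…,t_m,l} L^(t_1)L^(t_2)⋯L^(t_m) D^l with integer coefficients c_{k;t_1,…,t_m,l}, where the sum is over tuples (t_1,…,t_m) of nonnegative integers with m ≥ 1 and over l ≥ 0, and moreover every occurring monomial satisfies m + (t_1 + ⋯ + t_m) + l = k; in other words, the coefficient of D^{k−i} (for i ≥ 1) is a sum of monomials L^(t_1)⋯L^(t_m) whose multiple index m and partial degree j = t_1 + ⋯ + t_m satisfy m = i − j with 0 ≤ j ≤ i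 − 1. -/
/-- The monomial `L^(t₁)⋯L^(t_m) D^l` attached to `((t₁,…,t_m), l)`. -/
def standardMonomial {A : Type*} [Ring A] (D L : A) (p : List ℕ × ℕ) : A :=
  (p.1.map (adIter D L)).prod * D ^ p.2

/-- The integer span of the standard monomials of multiple index at least `r` and total
weight `k`. -/
def standardSpan {A : Type*} [Ring A] (D L : A) (r k : ℕ) : Submodule ℤ A :=
  Submodule.span ℤ (standardMonomial D L ''
    {p | r ≤ p.1.length ∧ p.1.length + p.1.sum + p.2 = k})

section

variable {A : Type*} [Ring A] {D L : A}

theorem standardMonomial_mem_standardSpan {r k : ℕ} {p : List ℕ × ℕ}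
    (hr : r ≤ p.1.length) (hk : p.1.length + p.1.sum + p.2 = k) :
    standardMonomial D L p ∈ standardSpan D L r k :=
  Submodule.subset_span ⟨p, ⟨hr, hk⟩, rfl⟩

theorem mul_mem_standardSpan_of_monomial {a x : A} {r k r' k' : ℕ}
    (h : ∀ p : List ℕ × ℕ, r ≤ p.1.length → p.1.length + p.1.sum + p.2 = k →
      a * standardMonomial D L p ∈ standardSpan D L r' k')
    (hx : x ∈ standardSpan D L r k) : a * x ∈ standardSpan D L r' k' := by
  have hle : standardSpan D L r k ≤
      (standardSpan D L r' k').comap (LinearMap.mulLeft ℤ a) := by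
    refine Submodule.span_le.mpr ?_
    rintro _ ⟨p, ⟨hr, hk⟩, rfl⟩
    exact h p hr hk
  exact hle hx

theorem standardSpan_antitone {r r' k : ℕ} (h : r ≤ r') :
    standardSpan D L r' k ≤ standardSpan D L r k :=
  Submodule.span_mono (Set.image_mono fun _ hp => ⟨h.trans hp.1, hp.2⟩)

theorem adIter_mul_mem_standardSpan (t : ℕ) {r k : ℕ} {x : A}
    (hx : x ∈ standardSpan D L r k) :
    adIter D L t * x ∈ standardSpan D L (r + 1) (k + t + 1) := by
  refine mul_mem_standardSpan_of_monomial (fun p hr hk => ?_) hx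
  have hp : adIter D L t * standardMonomial D L p = standardMonomial D L (t :: p.1, p.2) := by
    simp [standardMonomial, mul_assoc]
  rw [hp]
  refine standardMonomial_mem_standardSpan ?_ ?_ <;> simp <;> omega

theorem mul_standardMonomial_mem_standardSpan (ts : List ℕ) (l : ℕ) :
    D * standardMonomial D L (ts, l) ∈
      standardSpan D L ts.length (ts.length + ts.sum + l + 1) := by
  induction ts with
  | nil =>
    have hp : D * standardMonomial D L ([], l) = standardMonomial D L ([], l + 1) := by
      simp [standardMonomial, pow_succ']
    rw [hp]
    exact standardMonomial_mem_standardSpan (by simp) (by simp)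
  | cons t ts ih =>
    have hp : D * standardMonomial D L (t :: ts, l) =
        standardMonomial D L ((t + 1) :: ts, l) +
          adIter D L t * (D * standardMonomial D L (ts, l)) := by
      simp only [standardMonomial, List.map_cons, List.prod_cons, adIter]
      noncomm_ring
    rw [hp]
    have hweight : (t :: ts).length + (t :: ts).sum + l + 1 =
        ts.length + ts.sum + l + 1 + t + 1 := by
      rw [List.length_cons, List.sum_cons]
      omega
    rw [hweight, List.length_cons]
    refine add_mem (standardMonomial_mem_standardSpan ?_ ?_) (adIter_mul_mem_standardSpan t ih)
    · simp
    · rw [List.length_cons, List.sum_cons]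
      omega

theorem mul_mem_standardSpan {r k : ℕ} {x : A} (hx : x ∈ standardSpan D L r k) :
    D * x ∈ standardSpan D L r (k + 1) := by
  refine mul_mem_standardSpan_of_monomial (fun p hr hk => ?_) hx
  subst hk
  exact standardSpan_antitone hr (mul_standardMonomial_mem_standardSpan p.1 p.2)

theorem add_pow_sub_pow_mem_standardSpan (D L : A) (k : ℕ) :
    (D + L) ^ k - D ^ k ∈ standardSpan D L 1 k := by
  induction k with
  | zero => simp
  | succ k ih =>
    have hsplit : (D + L) ^ (k + 1) - D ^ (k + 1) =
        D * ((D + L) ^ k - D ^ k) + adIter D L 0 * ((D + L) ^ k - D ^ k) +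
          standardMonomial D L ([0], k) := by
      simp only [standardMonomial, List.map_cons, List.map_nil, List.prod_singleton, adIter,
        pow_succ']
      noncomm_ring
    rw [hsplit]
    refine add_mem (add_mem (mul_mem_standardSpan ih) ?_) ?_
    · exact standardSpan_antitone (by omega) (adIter_mul_mem_standardSpan 0 ih)
    · refine standardMonomial_mem_standardSpan ?_ ?_ <;> simp [add_comm]

end

/-- For every `k ≥ 1`, `(D+L)^k` can be written in standard form
`(D+L)^k = D^k + Σ c_{k;t₁,…,t_m,l} L^(t₁)⋯L^(t_m) D^l` with integer coefficients,
where the sum runs over tuples `(t₁,…,t_m)` of nonnegative integers with `m ≥ 1` and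
`l ≥ 0`, and every occurring monomial satisfies `m + (t₁ + ⋯ + t_m) + l = k`
(equivalently: the coefficient of `D^{k−i}` for `i ≥ 1` is a sum of monomials
`L^(t₁)⋯L^(t_m)` whose multiple index `m` and partial degree `j = t₁+⋯+t_m`
satisfy `m = i − j`, `0 ≤ j ≤ i − 1`). -/
theorem standard_form_of_power {A : Type*} [Ring A] (D L : A) (k : ℕ) (hk : 1 ≤ k) :
    ∃ (S : Finset (List ℕ × ℕ)) (c : List ℕ × ℕ → ℤ),
      (∀ p ∈ S, 1 ≤ p.1.length ∧ p.1.length + p.1.sum + p.2 = k) ∧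
      (D + L) ^ k =
        D ^ k + ∑ p ∈ S, c p • ((p.1.map (adIter D L)).prod * D ^ p.2) := by
  obtain ⟨c, hc, hsum⟩ := (Finsupp.mem_span_image_iff_linearCombination ℤ).mp
    (add_pow_sub_pow_mem_standardSpan D L k)
  refine ⟨c.support, c, fun p hp => hc hp, ?_⟩
  rw [← sub_eq_iff_eq_add', ← hsum]
  rfl
end

section
/- Let A be an associative unital ring, D, L ∈ A, L^(t) = ad(D)^t(L), and for integers k ≥ 1, 1 ≤ i ≤ k, 0 ≤ j ≤ i−1 define T_{i,j,k} = C(k,i) · Σ g(t_1,…,t_m) L^(t_1)⋯L^(t_m), the sum over tuples of nonnegative integers with m = i − j and t_1 + ⋯ + t_m = j. Then the following recursion relations hold for k ≥ 2: T_{1,0,k} = T_{1,0,k−1} + L = kL; for 1 < s < k: T_{s,0,k} = T_{s,0,k−1} + L·T_{s−1,0,k−1}; for 1 < s < k and 0 < j < s−1: T_{s,j,k} = T_{s,j,k−1} + [D, T_{s−1,j−1,k−1}] + L·T_{s−1,j,k−1}; for 1 < s < k: T_{s,s−1,k} = T_{s,s−1,k−1} + [D, T_{s−1,s−2,k−1}];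 and for s = k: T_{k,0,k} = L·T_{k−1,0,k−1}, T_{k,j,k} = L·T_{k−1,j,k−1} + [D, T_{k−1,j−1,k−1}] for 0 < j < k−1, and T_{k,k−1,k} = [D, T_{k−1,k−2,k−1}]. -/
/-- The Leibniz rule for the inner derivation `Z ↦ D * Z - Z * D` on a finite product. -/
theorem commutator_prod_ofFn {A : Type*} [Ring A] (D : A) (m : ℕ) (f : Fin m → A) :
    D * (List.ofFn f).prod - (List.ofFn f).prod * D =
      ∑ r, (List.ofFn (Function.update f r (D * f r - f r * D))).prod := by
  induction m with
  | zero => simp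
  | succ m ih =>
    have h : ∀ r : Fin m, (fun i : Fin m =>
        Function.update f r.succ (D * f r.succ - f r.succ * D) i.succ) =
        Function.update (fun i : Fin m => f i.succ) r (D * f r.succ - f r.succ * D) := by
      intro r
      ext i
      simp [Function.update_apply]
    have h0 : ∀ a : A, (fun i : Fin m => Function.update f 0 a i.succ) = fun i => f i.succ := by
      intro a
      ext i
      simp
    have h1 : ∀ (r : Fin m) (a : A), Function.update f r.succ a 0 = f 0 := by
      intro r a
      simp [(Fin.succ_ne_zero r).symm]
    simp only [List.ofFn_succ, List.prod_cons, Fin.sum_univ_succ, h, h0, h1,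
      Function.update_self, ← Finset.mul_sum, ← ih fun i => f i.succ]
    noncomm_ring

theorem List.getD_ofFn_val {m : ℕ} (t : Fin m → ℕ) (r : Fin m) :
    (List.ofFn t).getD r 0 = t r := by
  simp [List.getD_eq_getElem?_getD]

theorem List.set_ofFn_val {m : ℕ} (t : Fin m → ℕ) (r : Fin m) (a : ℕ) :
    (List.ofFn t).set r a = List.ofFn (Function.update t r a) := by
  apply List.ext_getElem
  · simp
  · intro i h₁ h₂
    simp only [List.getElem_set, List.getElem_ofFn, Function.update_apply, Fin.ext_iff]
    grind

/-- The defining recursion of `gfun`, uniformly in the first entry. -/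
theorem gfun_ofFn {m : ℕ} (t : Fin (m + 2) → ℕ) :
    gfun (List.ofFn t) =
      (if t 0 = 0 then gfun (List.ofFn fun i : Fin (m + 1) => t i.succ) else 0) +
      ∑ r, if t r = 0 then 0 else gfun (List.ofFn (Function.update t r (t r - 1))) := by
  have hg : ∀ (a : ℕ) (u : Fin (m + 1) → ℕ), gfun (a :: List.ofFn u) =
      (if a = 0 then gfun (List.ofFn u) else gfun ((a - 1) :: List.ofFn u)) +
      ∑ r : Fin (m + 1), if u r = 0 then 0
        else gfun (a :: List.ofFn (Function.update u r (u r - 1))) := by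
    intro a u
    have hs : ∀ r : Fin (m + 1), (if u r = 0 then 0
        else gfun (a :: List.ofFn (Function.update u r (u r - 1)))) =
        (fun r : ℕ => if (List.ofFn u).getD r 0 = 0 then 0
          else gfun (a :: (List.ofFn u).set r ((List.ofFn u).getD r 0 - 1))) r := by
      intro r
      simp only [List.getD_ofFn_val, List.set_ofFn_val]
    rw [Finset.sum_congr rfl fun r _ => hs r, Fin.sum_univ_eq_sum_range (fun r : ℕ =>
      if (List.ofFn u).getD r 0 = 0 then 0
        else gfun (a :: (List.ofFn u).set r ((List.ofFn u).getD r 0 - 1)))]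
    rw [List.ofFn_succ, gfun]
    simp
  have h : ∀ r : Fin (m + 1), List.ofFn (Function.update t r.succ (t r.succ - 1)) =
      t 0 :: List.ofFn (Function.update (fun i : Fin (m + 1) => t i.succ) r (t r.succ - 1)) := by
    intro r
    rw [List.ofFn_succ]
    refine congrArg₂ List.cons
      (Function.update_of_ne (Fin.succ_ne_zero r).symm _ _)
      (congrArg List.ofFn (funext fun i => ?_))
    simp [Function.update_apply]
  have h0 : List.ofFn (Function.update t 0 (t 0 - 1)) =
      (t 0 - 1) :: List.ofFn fun i : Fin (m + 1) => t i.succ := by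
    simp [List.ofFn_succ]
  rw [List.ofFn_succ, hg, Fin.sum_univ_succ (fun r => if t r = 0 then 0 else _), h0]
  simp only [h]
  split_ifs <;> ring

/-- `T_{i,j,k}` without its binomial factor, indexed by the length `m` and the sum `n`. -/
def tupleSum {A : Type*} [Ring A] (D L : A) (m n : ℕ) : A :=
  ∑ t ∈ Finset.Nat.antidiagonalTuple m n,
    gfun (List.ofFn t) • (List.ofFn fun r => adIter D L (t r)).prod

theorem Tcoef_eq {A : Type*} [Ring A] (D L : A) (i j k : ℕ) :
    Tcoef D L i j k = k.choose i • tupleSum D L (i - j) j := rfl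

theorem Finset.Nat.sum_antidiagonalTuple_succ_of_pos {M : Type*} [AddCommMonoid M] {m : ℕ} (n : ℕ)
    (r : Fin m) (f : (Fin m → ℕ) → (Fin m → ℕ) → M) :
    ∑ t ∈ Finset.Nat.antidiagonalTuple m (n + 1),
        (if t r = 0 then 0 else f (Function.update t r (t r - 1)) t) =
      ∑ t ∈ Finset.Nat.antidiagonalTuple m n, f t (Function.update t r (t r + 1)) := by
  simp_rw [← ite_not (_ = 0)]
  rw [← Finset.sum_filter]
  refine Finset.sum_nbij' (fun t => Function.update t r (t r - 1))
    (fun t => Function.update t r (t r + 1)) ?_ ?_ ?_ ?_ ?_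
  · intro t ht
    simp only [Finset.mem_filter, Finset.Nat.mem_antidiagonalTuple] at ht ⊢
    have h := Finset.add_sum_erase Finset.univ t (Finset.mem_univ r)
    rw [Finset.sum_update_of_mem (Finset.mem_univ r), ← Finset.erase_eq]
    omega
  · intro t ht
    simp only [Finset.mem_filter, Finset.Nat.mem_antidiagonalTuple] at ht ⊢
    have h := Finset.add_sum_erase Finset.univ t (Finset.mem_univ r)
    rw [Finset.sum_update_of_mem (Finset.mem_univ r), ← Finset.erase_eq]
    refine ⟨by omega, by simp⟩
  · intro t ht
    simp only [Finset.mem_filter] at ht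
    have h : t r - 1 + 1 = t r := by omega
    simp [h]
  · intro t _
    simp
  · intro t ht
    simp only [Finset.mem_filter] at ht
    have h : t r - 1 + 1 = t r := by omega
    simp [h]

theorem Finset.Nat.sum_antidiagonalTuple_of_head_eq_zero {M : Type*} [AddCommMonoid M] (m n : ℕ)
    (f : (Fin (m + 1) → ℕ) → M) :
    ∑ t ∈ Finset.Nat.antidiagonalTuple (m + 1) n, (if t 0 = 0 then f t else 0) =
      ∑ t ∈ Finset.Nat.antidiagonalTuple m n, f (Fin.cons 0 t) := by
  rw [← Finset.sum_filter]
  refine Finset.sum_nbij' (fun t => Fin.tail t) (fun t => Fin.cons 0 t) ?_ ?_ ?_ ?_ ?_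
  · intro t ht
    simp only [Finset.mem_filter, Finset.Nat.mem_antidiagonalTuple, Fin.sum_univ_succ] at ht ⊢
    simp only [Fin.tail]
    omega
  · intro t ht
    simpa [Finset.Nat.mem_antidiagonalTuple, Fin.sum_univ_succ] using ht
  · intro t ht
    simp only [Finset.mem_filter] at ht
    rw [← ht.2, Fin.cons_self_tail]
  · intro t _
    simp
  · intro t ht
    simp only [Finset.mem_filter] at ht
    rw [← ht.2, Fin.cons_self_tail]

theorem tupleSum_one {A : Type*} [Ring A] (D L : A) (n : ℕ) :
    tupleSum D L 1 n = adIter D L n := by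
  simp [tupleSum, gfun]

theorem tupleSum_eq {A : Type*} [Ring A] (D L : A) (m n : ℕ) :
    tupleSum D L (m + 2) n = L * tupleSum D L (m + 1) n +
      ∑ t ∈ Finset.Nat.antidiagonalTuple (m + 2) n, ∑ r, if t r = 0 then 0 else
        gfun (List.ofFn (Function.update t r (t r - 1))) •
          (List.ofFn fun i => adIter D L (t i)).prod := by
  rw [tupleSum, Finset.sum_congr rfl fun t _ => by rw [gfun_ofFn t]]
  simp only [add_smul, Finset.sum_add_distrib, ite_smul, zero_smul, Finset.sum_smul]
  rw [Finset.Nat.sum_antidiagonalTuple_of_head_eq_zero, tupleSum, Finset.mul_sum]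
  congr 1
  refine Finset.sum_congr rfl fun t _ => ?_
  rw [List.ofFn_succ (f := fun i => adIter D L _), mul_smul_comm]
  simp only [Fin.cons_zero, Fin.cons_succ, List.prod_cons, adIter]

theorem tupleSum_zero {A : Type*} [Ring A] (D L : A) (m : ℕ) :
    tupleSum D L (m + 2) 0 = L * tupleSum D L (m + 1) 0 := by
  rw [tupleSum_eq, Finset.Nat.antidiagonalTuple_zero_right]
  simp

theorem tupleSum_succ {A : Type*} [Ring A] (D L : A) (m n : ℕ) :
    tupleSum D L (m + 2) (n + 1) = L * tupleSum D L (m + 1) (n + 1) +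
      (D * tupleSum D L (m + 2) n - tupleSum D L (m + 2) n * D) := by
  rw [tupleSum_eq]
  congr 1
  rw [Finset.sum_comm]
  have h : ∀ r : Fin (m + 2), _ := fun r =>
    Finset.Nat.sum_antidiagonalTuple_succ_of_pos n r
      (fun u t => gfun (List.ofFn u) • (List.ofFn fun i => adIter D L (t i)).prod)
  rw [Finset.sum_congr rfl fun r _ => h r, Finset.sum_comm, tupleSum, Finset.mul_sum,
    Finset.sum_mul, ← Finset.sum_sub_distrib]
  refine Finset.sum_congr rfl fun t _ => ?_
  rw [mul_smul_comm, smul_mul_assoc, ← smul_sub, commutator_prod_ofFn, Finset.smul_sum]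
  refine Finset.sum_congr rfl fun r _ => ?_
  congr 3
  ext i
  by_cases hi : i = r
  · subst hi
    simp [adIter]
  · simp [hi]

/-- The recursion relations for `T_{i,j,k}` (here `[D, X] = D*X − X*D`):
`T_{1,0,k} = T_{1,0,k−1} + L = k·L`; for `1 < s < k`:
`T_{s,0,k} = T_{s,0,k−1} + L·T_{s−1,0,k−1}`,
`T_{s,j,k} = T_{s,j,k−1} + [D,T_{s−1,j−1,k−1}] + L·T_{s−1,j,k−1}` for `0 < j < s−1`,
`T_{s,s−1,k} = T_{s,s−1,k−1} + [D,T_{s−1,s−2,k−1}]`; and for `s = k`: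
`T_{k,0,k} = L·T_{k−1,0,k−1}`,
`T_{k,j,k} = L·T_{k−1,j,k−1} + [D,T_{k−1,j−1,k−1}]` for `0 < j < k−1`,
`T_{k,k−1,k} = [D,T_{k−1,k−2,k−1}]`. -/
theorem Tcoef_recursion {A : Type*} [Ring A] (D L : A) (k : ℕ) (hk : 2 ≤ k) :
    (Tcoef D L 1 0 k = Tcoef D L 1 0 (k - 1) + L ∧ Tcoef D L 1 0 k = k • L) ∧
    (∀ s : ℕ, 1 < s → s < k →
      Tcoef D L s 0 k = Tcoef D L s 0 (k - 1) + L * Tcoef D L (s - 1) 0 (k - 1)) ∧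
    (∀ s j : ℕ, 1 < s → s < k → 0 < j → j < s - 1 →
      Tcoef D L s j k = Tcoef D L s j (k - 1)
        + (D * Tcoef D L (s - 1) (j - 1) (k - 1)
            - Tcoef D L (s - 1) (j - 1) (k - 1) * D)
        + L * Tcoef D L (s - 1) j (k - 1)) ∧
    (∀ s : ℕ, 1 < s → s < k →
      Tcoef D L s (s - 1) k = Tcoef D L s (s - 1) (k - 1)
        + (D * Tcoef D L (s - 1) (s - 2) (k - 1)
            - Tcoef D L (s - 1) (s - 2) (k - 1) * D)) ∧
    (Tcoef D L k 0 k = L * Tcoef D L (k - 1) 0 (k - 1)) ∧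
    (∀ j : ℕ, 0 < j → j < k - 1 →
      Tcoef D L k j k = L * Tcoef D L (k - 1) j (k - 1)
        + (D * Tcoef D L (k - 1) (j - 1) (k - 1)
            - Tcoef D L (k - 1) (j - 1) (k - 1) * D)) ∧
    (Tcoef D L k (k - 1) k
      = D * Tcoef D L (k - 1) (k - 2) (k - 1)
          - Tcoef D L (k - 1) (k - 2) (k - 1) * D) := by
  obtain ⟨k, rfl⟩ : ∃ l, k = l + 2 := ⟨k - 2, by omega⟩
  have pascal : ∀ s : ℕ, (k + 2).choose (s + 1) = (k + 1).choose s + (k + 1).choose (s + 1) :=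
    fun s => Nat.choose_succ_succ _ _
  simp only [Tcoef_eq, Nat.add_sub_cancel, show k + 2 - 1 = k + 1 by omega]
  refine ⟨⟨?_, ?_⟩, ?_, ?_, ?_, ?_, ?_, ?_⟩
  · simp only [Nat.choose_one_right, Nat.sub_zero, tupleSum_one, adIter]
    rw [← succ_nsmul]
  · simp [tupleSum_one, adIter]
  · intro s hs _
    obtain ⟨s, rfl⟩ : ∃ l, s = l + 2 := ⟨s - 2, by omega⟩
    simp only [show s + 2 - 1 = s + 1 by omega, Nat.sub_zero, pascal (s + 1), tupleSum_zero,
      add_smul, mul_smul_comm]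
    abel
  · intro s j hs _ hj hjs
    obtain ⟨j, rfl⟩ : ∃ l, j = l + 1 := ⟨j - 1, by omega⟩
    obtain ⟨m, rfl⟩ : ∃ l, s = l + 2 + (j + 1) := ⟨s - 2 - (j + 1), by omega⟩
    simp only [show m + 2 + (j + 1) - (j + 1) = m + 2 by omega,
      show m + 2 + (j + 1) - 1 = m + 2 + j by omega, show m + 2 + j - (j + 1) = m + 1 by omega,
      Nat.add_sub_cancel, tupleSum_succ, mul_smul_comm, smul_mul_assoc]
    rw [show m + 2 + (j + 1) = m + 2 + j + 1 by omega, pascal]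
    simp only [add_smul, smul_add, smul_sub]
    abel
  · intro s hs _
    obtain ⟨s, rfl⟩ : ∃ l, s = l + 2 := ⟨s - 2, by omega⟩
    simp only [show s + 2 - 1 = s + 1 by omega, show s + 2 - (s + 1) = 1 by omega,
      show s + 1 - s = 1 by omega, Nat.add_sub_cancel, pascal (s + 1), tupleSum_one, adIter,
      add_smul, smul_sub, mul_smul_comm, smul_mul_assoc]
    abel
  · simp [tupleSum_zero]
  · intro j hj hjk
    obtain ⟨j, rfl⟩ : ∃ l, j = l + 1 := ⟨j - 1, by omega⟩
    obtain ⟨m, rfl⟩ : ∃ l, k = l + (j + 1) := ⟨k - (j + 1), by omega⟩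
    simp only [show m + (j + 1) + 2 - (j + 1) = m + 2 by omega,
      show m + (j + 1) + 1 - (j + 1) = m + 1 by omega, show m + (j + 1) + 1 - j = m + 2 by omega,
      Nat.add_sub_cancel, Nat.choose_self, one_smul, tupleSum_succ]
  · simp only [show k + 2 - (k + 1) = 1 by omega, show k + 1 - k = 1 by omega,
      Nat.choose_self, one_smul, tupleSum_one, adIter]
end

section
/- Let A be an associative unital ring and D, L ∈ A, with L^(t) = ad(D)^t(L). For every integer k ≥ 1 there exist integer coefficients c_{t_1,…,t_m} such that (D+L)^k = Σ_{i=0}^{k} C(k,i) L^i D^{k−i} + R, where R is a finite integer-linear combination of monomials L^(t_1)L^(t_2)⋯L^(t_m) D^l in which (t_1,…,t_m) is a tuple of nonnegative integers with t_1 + ⋯ + t_m ≥ 1 and m + (t_1 + ⋯ + t_m) + l = k; that is, modulo monomials involving at least one genuine commutator factor L^(t) with t ≥ 1, the power (D+L)^k equals the binomial expansion Σ_{i=0}^{k} C(k,i) L^i D^{k−i}. -/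
/-- The integer span of the monomials `L^(t₁)⋯L^(t_m) D^l` of weight `m + Σ tᵢ + l = k` having at
least one genuine commutator factor. -/
def commutatorSpan {A : Type*} [Ring A] (D L : A) (k : ℕ) : Submodule ℤ A :=
  Submodule.span ℤ ((fun p : List ℕ × ℕ => (p.1.map (adIter D L)).prod * D ^ p.2) ''
    {p | 1 ≤ p.1.sum ∧ p.1.length + p.1.sum + p.2 = k})

theorem monomial_mem_commutatorSpan {A : Type*} [Ring A] (D L : A) {k : ℕ} (ts : List ℕ) (l : ℕ)
    (h₁ : 1 ≤ ts.sum) (h₂ : ts.length + ts.sum + l = k) :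
    (ts.map (adIter D L)).prod * D ^ l ∈ commutatorSpan D L k :=
  Submodule.subset_span ⟨(ts, l), ⟨h₁, h₂⟩, rfl⟩

/-- The commutator of `D` with a product of `L^(t)`s is an integer combination of products of the
same length whose total order is larger by one. -/
theorem commutator_prod_mem_span {A : Type*} [Ring A] (D L : A) (ts : List ℕ) :
    D * (ts.map (adIter D L)).prod - (ts.map (adIter D L)).prod * D ∈
      Submodule.span ℤ ((fun us : List ℕ => (us.map (adIter D L)).prod) ''
        {us | us.length = ts.length ∧ us.sum = ts.sum + 1}) := by
  induction ts with
  | nil => simp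
  | cons t ts ih =>
    have leibniz : D * ((t :: ts).map (adIter D L)).prod - ((t :: ts).map (adIter D L)).prod * D =
        (((t + 1) :: ts).map (adIter D L)).prod +
          adIter D L t * (D * (ts.map (adIter D L)).prod - (ts.map (adIter D L)).prod * D) := by
      simp only [List.map_cons, List.prod_cons, adIter]
      noncomm_ring
    rw [leibniz]
    refine add_mem (Submodule.subset_span ⟨_, ⟨by simp, by simp; omega⟩, rfl⟩) ?_
    refine Submodule.span_induction (p := fun x _ => adIter D L t * x ∈ _) ?_ ?_ ?_ ?_ ih
    · rintro _ ⟨us, ⟨h₁, h₂⟩, rfl⟩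
      exact Submodule.subset_span ⟨t :: us, ⟨by simp [h₁], by simp [h₂]; omega⟩, by simp⟩
    · simp
    · intro x y _ _ hx hy
      rw [mul_add]
      exact add_mem hx hy
    · intro n x _ hx
      rw [mul_smul_comm]
      exact Submodule.smul_mem _ n hx

theorem commutator_prod_mul_pow_mem {A : Type*} [Ring A] (D L : A) {k : ℕ} (ts : List ℕ) (l : ℕ)
    (h : ts.length + ts.sum + l = k) :
    (D * (ts.map (adIter D L)).prod - (ts.map (adIter D L)).prod * D) * D ^ l ∈
      commutatorSpan D L (k + 1) := by
  refine Submodule.span_induction (p := fun x _ => x * D ^ l ∈ _) ?_ ?_ ?_ ?_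
    (commutator_prod_mem_span D L ts)
  · rintro _ ⟨us, ⟨h₁, h₂⟩, rfl⟩
    exact monomial_mem_commutatorSpan D L us l (by omega) (by omega)
  · simp
  · intro x y _ _ hx hy
    rw [add_mul]
    exact add_mem hx hy
  · intro n x _ hx
    rw [smul_mul_assoc]
    exact Submodule.smul_mem _ n hx

theorem add_mul_mem_commutatorSpan {A : Type*} [Ring A] (D L : A) {k : ℕ} {x : A}
    (hx : x ∈ commutatorSpan D L k) : (D + L) * x ∈ commutatorSpan D L (k + 1) := by
  refine Submodule.span_induction (p := fun x _ => (D + L) * x ∈ _) ?_ ?_ ?_ ?_ hx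
  · rintro _ ⟨⟨ts, l⟩, ⟨h₁, h₂⟩, rfl⟩
    dsimp only at h₁ h₂ ⊢
    have expand : (D + L) * ((ts.map (adIter D L)).prod * D ^ l) =
        (D * (ts.map (adIter D L)).prod - (ts.map (adIter D L)).prod * D) * D ^ l +
          (ts.map (adIter D L)).prod * D ^ (l + 1) +
          ((0 :: ts).map (adIter D L)).prod * D ^ l := by
      simp only [List.map_cons, List.prod_cons, adIter, pow_succ']
      noncomm_ring
    rw [expand]
    refine add_mem (add_mem (commutator_prod_mul_pow_mem D L ts l h₂) ?_) ?_
    · exact monomial_mem_commutatorSpan D L ts (l + 1) h₁ (by omega)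
    · exact monomial_mem_commutatorSpan D L (0 :: ts) l (by simpa using h₁) (by simp; omega)
  · simp
  · intro x y _ _ hx hy
    rw [mul_add]
    exact add_mem hx hy
  · intro n x _ hx
    rw [mul_smul_comm]
    exact Submodule.smul_mem _ n hx

theorem add_mul_pow_mul_pow_sub_mem {A : Type*} [Ring A] (D L : A) (i j : ℕ) :
    (D + L) * (L ^ i * D ^ j) - (L ^ i * D ^ (j + 1) + L ^ (i + 1) * D ^ j) ∈
      commutatorSpan D L (i + j + 1) := by
  have h := commutator_prod_mul_pow_mem D L (List.replicate i 0) j (k := i + j) (by simp)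
  simp only [List.map_replicate, List.prod_replicate, adIter] at h
  convert h using 1
  simp only [pow_succ']
  noncomm_ring

theorem add_pow_sub_binomial_mem_commutatorSpan {A : Type*} [Ring A] (D L : A) (k : ℕ) :
    (D + L) ^ k - ∑ i ∈ Finset.range (k + 1), k.choose i • (L ^ i * D ^ (k - i)) ∈
      commutatorSpan D L k := by
  induction k with
  | zero => simp
  | succ k ih =>
    have pascal := Finset.sum_choose_succ_nsmul (fun i j => L ^ i * D ^ j) k
    have split : (D + L) ^ (k + 1) -
        ∑ i ∈ Finset.range (k + 1 + 1), (k + 1).choose i • (L ^ i * D ^ (k + 1 - i)) =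
        (D + L) * ((D + L) ^ k -
          ∑ i ∈ Finset.range (k + 1), k.choose i • (L ^ i * D ^ (k - i))) +
        ∑ i ∈ Finset.range (k + 1), k.choose i • ((D + L) * (L ^ i * D ^ (k - i)) -
          (L ^ i * D ^ (k + 1 - i) + L ^ (i + 1) * D ^ (k - i))) := by
      simp only [smul_sub, smul_add, Finset.sum_sub_distrib, Finset.sum_add_distrib, mul_sub,
        Finset.mul_sum, mul_smul_comm, pow_succ' (D + L) k]
      rw [pascal]
      abel
    rw [split]
    refine add_mem (add_mul_mem_commutatorSpan D L ih) (sum_mem fun i hi => nsmul_mem ?_ _)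
    have hik : i ≤ k := Nat.lt_succ_iff.mp (Finset.mem_range.mp hi)
    have h := add_mul_pow_mul_pow_sub_mem D L i (k - i)
    rwa [Nat.add_sub_cancel' hik, ← Nat.sub_add_comm hik] at h

/-- For every `k ≥ 1`,
`(D+L)^k = Σ_{i=0}^{k} C(k,i) L^i D^{k−i} + R`, where `R` is a finite integer-linear
combination of monomials `L^(t₁)L^(t₂)⋯L^(t_m) D^l` in which `(t₁,…,t_m)` is a tuple of
nonnegative integers with `t₁ + ⋯ + t_m ≥ 1` and `m + (t₁ + ⋯ + t_m) + l = k`; i.e.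
modulo monomials involving at least one genuine commutator factor `L^(t)` with `t ≥ 1`,
the power `(D+L)^k` equals the binomial expansion `Σ_{i=0}^{k} C(k,i) L^i D^{k−i}`. -/
theorem power_eq_binomial_plus_commutator_terms {A : Type*} [Ring A] (D L : A)
    (k : ℕ) (hk : 1 ≤ k) :
    ∃ (S : Finset (List ℕ × ℕ)) (c : List ℕ × ℕ → ℤ),
      (∀ p ∈ S, 1 ≤ p.1.sum ∧ p.1.length + p.1.sum + p.2 = k) ∧
      (D + L) ^ k =
        (∑ i ∈ Finset.range (k + 1), k.choose i • (L ^ i * D ^ (k - i)))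
          + ∑ p ∈ S, c p • ((p.1.map (adIter D L)).prod * D ^ p.2) := by
  obtain ⟨c, hc, hsum⟩ := (Finsupp.mem_span_image_iff_linearCombination ℤ).mp
    (add_pow_sub_binomial_mem_commutatorSpan D L k)
  refine ⟨c.support, c, fun p hp => hc hp, ?_⟩
  rw [← sub_eq_iff_eq_add', ← hsum, Finsupp.linearCombination_apply, Finsupp.sum]
end

section
/- Let p ∈ ℤ and let E ⊆ ℤ_{≥0} × ℤ satisfy: (0,p) ∈ E; every (l,j) ∈ E has j ≤ p; every (l,j) ∈ E with j = p has l = 0; and every (l,j) ∈ E with j < p has l < p − j. Then exactly one of the following three conditions holds: (1) every (l,j) ∈ E has l = 0; (2) some (l,j) ∈ E has l > 0 and E has a restriction top line, i.e. there is σ > 0 with sup{σ·l + j : (l,j) ∈ E} = p attained at some point with l > 0; (3) some (l,j) ∈ E has l > 0, E has no restriction top line, and E has an asymptotic top line, i.e. there is σ_0 > 0 with sup{σ_0·l + j : (l,j) ∈ E} = p such that for every σ > σ_0 one has sup{σ·l + j : (l,j) ∈ E} > p. Moreover, in case (3) the asymptotic top line is unique: there is exactly one such σ_0. -/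
/-- The weight `v_{σ,1}(E) = sup {σ·l + j : (l,j) ∈ E} ∈ ℝ ∪ {±∞}` of a subset
`E ⊆ ℤ_{≥0} × ℤ`. -/
noncomputable def vWeight (E : Set (ℕ × ℤ)) (σ : ℝ) : EReal :=
  sSup {x : EReal | ∃ q ∈ E, x = ((σ * (q.1 : ℝ) + (q.2 : ℝ) : ℝ) : EReal)}

/-- The line `σX + Y = p` is a restriction top line of `E` (relative to `p`) if
`v_{σ,1}(E) = p` and some point `(l,j) ∈ E` with `l > 0` lies on the line. -/
def IsRestrictionTopLine (E : Set (ℕ × ℤ)) (p : ℤ) (σ : ℝ) : Prop :=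
  vWeight E σ = (((p : ℝ) : EReal)) ∧
    ∃ q ∈ E, 0 < q.1 ∧ σ * (q.1 : ℝ) + (q.2 : ℝ) = (p : ℝ)

/-- The line `σ₀X + Y = p` is an asymptotic top line of `E` (relative to `p`) if
`v_{σ₀,1}(E) = p` and `v_{σ,1}(E) > p` for every `σ > σ₀`. -/
def IsAsymptoticTopLine (E : Set (ℕ × ℤ)) (p : ℤ) (σ₀ : ℝ) : Prop :=
  vWeight E σ₀ = (((p : ℝ) : EReal)) ∧
    ∀ σ : ℝ, σ₀ < σ → (((p : ℝ) : EReal)) < vWeight E σ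

theorem vWeight_le_iff (E : Set (ℕ × ℤ)) (σ c : ℝ) :
    vWeight E σ ≤ (c : EReal) ↔ ∀ q ∈ E, σ * (q.1 : ℝ) + (q.2 : ℝ) ≤ c := by
  rw [vWeight, sSup_le_iff]
  constructor
  · exact fun h q hq => EReal.coe_le_coe_iff.mp (h _ ⟨q, hq, rfl⟩)
  · rintro h _ ⟨q, hq, rfl⟩
    exact EReal.coe_le_coe_iff.mpr (h q hq)

theorem le_vWeight_of_mem {p : ℤ} {E : Set (ℕ × ℤ)} (h0 : (0, p) ∈ E) (σ : ℝ) :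
    ((p : ℝ) : EReal) ≤ vWeight E σ :=
  le_sSup ⟨(0, p), h0, by simp⟩

theorem IsAsymptoticTopLine.unique {p : ℤ} {E : Set (ℕ × ℤ)} {σ τ : ℝ}
    (hσ : IsAsymptoticTopLine E p σ) (hτ : IsAsymptoticTopLine E p τ) : σ = τ := by
  rcases lt_trichotomy σ τ with h | h | h
  · exact absurd hτ.1 (hσ.2 τ h).ne'
  · exact h
  · exact absurd hσ.1 (hτ.2 σ h).ne'

/-- If some slope `τ` has weight at most `p` and `E` contains `(0, p)` and a point off the
vertical axis, then the largest slope of weight at most `p` gives an asymptotic top line. -/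
theorem exists_isAsymptoticTopLine {p : ℤ} {E : Set (ℕ × ℤ)} {τ : ℝ} (h0 : (0, p) ∈ E)
    (hE : ∃ q ∈ E, 0 < q.1) (hτ : ∀ q ∈ E, τ * (q.1 : ℝ) + (q.2 : ℝ) ≤ p) :
    ∃ σ₀ : ℝ, τ ≤ σ₀ ∧ IsAsymptoticTopLine E p σ₀ := by
  let S : Set ℝ := {σ | ∀ q ∈ E, σ * (q.1 : ℝ) + (q.2 : ℝ) ≤ p}
  have hbdd : BddAbove S := by
    obtain ⟨q, hq, hl⟩ := hE
    refine ⟨((p : ℝ) - q.2) / q.1, fun σ hσ => ?_⟩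
    rw [le_div_iff₀ (Nat.cast_pos.mpr hl)]
    linarith [hσ q hq]
  have hclosed : IsClosed S := by
    simp only [S, Set.ofPred_forall]
    exact isClosed_biInter fun q _ => isClosed_le (by fun_prop) continuous_const
  have hmem : sSup S ∈ S := hclosed.csSup_mem ⟨τ, hτ⟩ hbdd
  refine ⟨sSup S, le_csSup hbdd hτ,
    le_antisymm ((vWeight_le_iff E _ _).mpr hmem) (le_vWeight_of_mem h0 _), fun σ hσ => ?_⟩
  by_contra h
  exact hσ.not_ge (le_csSup hbdd ((vWeight_le_iff E σ p).mp (not_lt.mp h)))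

/-- Trichotomy for the Newton region of an operator satisfying condition `A_k(0)`:
exactly one of the following holds: (1) every point of `E` has first coordinate `0`;
(2) some point has positive first coordinate and `E` has a restriction top line;
(3) some point has positive first coordinate, `E` has no restriction top line, and
`E` has an asymptotic top line, which moreover is unique. -/
theorem restriction_or_asymptotic_trichotomy (p : ℤ) (E : Set (ℕ × ℤ))
    (h0 : (0, p) ∈ E)
    (h1 : ∀ q ∈ E, q.2 ≤ p)
    (h2 : ∀ q ∈ E, q.2 = p → q.1 = 0)
    (h3 : ∀ q ∈ E, q.2 < p → (q.1 : ℤ) < p - q.2) :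
    ((∀ q ∈ E, q.1 = 0) ∧
      ¬((∃ q ∈ E, 0 < q.1) ∧ ∃ σ : ℝ, 0 < σ ∧ IsRestrictionTopLine E p σ) ∧
      ¬((∃ q ∈ E, 0 < q.1) ∧ (¬∃ σ : ℝ, 0 < σ ∧ IsRestrictionTopLine E p σ) ∧
          (∃! σ₀ : ℝ, 0 < σ₀ ∧ IsAsymptoticTopLine E p σ₀))) ∨
    (¬(∀ q ∈ E, q.1 = 0) ∧
      ((∃ q ∈ E, 0 < q.1) ∧ ∃ σ : ℝ, 0 < σ ∧ IsRestrictionTopLine E p σ) ∧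
      ¬((∃ q ∈ E, 0 < q.1) ∧ (¬∃ σ : ℝ, 0 < σ ∧ IsRestrictionTopLine E p σ) ∧
          (∃! σ₀ : ℝ, 0 < σ₀ ∧ IsAsymptoticTopLine E p σ₀))) ∨
    (¬(∀ q ∈ E, q.1 = 0) ∧
      ¬((∃ q ∈ E, 0 < q.1) ∧ ∃ σ : ℝ, 0 < σ ∧ IsRestrictionTopLine E p σ) ∧
      ((∃ q ∈ E, 0 < q.1) ∧ (¬∃ σ : ℝ, 0 < σ ∧ IsRestrictionTopLine E p σ) ∧
          (∃! σ₀ : ℝ, 0 < σ₀ ∧ IsAsymptoticTopLine E p σ₀))) := by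
  have hone : ∀ q ∈ E, (1 : ℝ) * (q.1 : ℝ) + (q.2 : ℝ) ≤ p := by
    intro q hq
    have h : (q.1 : ℤ) + q.2 ≤ p := by
      rcases (h1 q hq).lt_or_eq with hj | hj
      · linarith [h3 q hq hj]
      · simp [h2 q hq hj, hj]
    rw [one_mul]
    exact_mod_cast h
  by_cases hE : ∃ q ∈ E, 0 < q.1
  · have hA : ∃! σ₀ : ℝ, 0 < σ₀ ∧ IsAsymptoticTopLine E p σ₀ := by
      obtain ⟨σ₀, hσ₀, h⟩ := exists_isAsymptoticTopLine h0 hE hone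
      exact ⟨σ₀, ⟨one_pos.trans_le hσ₀, h⟩, fun _ hτ => hτ.2.unique h⟩
    have hE' : ¬∀ q ∈ E, q.1 = 0 := fun h => by
      obtain ⟨q, hq, hl⟩ := hE
      exact hl.ne' (h q hq)
    by_cases hR : ∃ σ : ℝ, 0 < σ ∧ IsRestrictionTopLine E p σ
    · exact Or.inr (Or.inl ⟨hE', ⟨hE, hR⟩, fun h => h.2.1 hR⟩)
    · exact Or.inr (Or.inr ⟨hE', fun h => hR h.2, hE, hR, hA⟩)
  · have hE' : ∀ q ∈ E, q.1 = 0 := fun q hq =>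
      Nat.eq_zero_of_not_pos fun hl => hE ⟨q, hq, hl⟩
    exact Or.inl ⟨hE', fun h => hE h.1, fun h => hE h.1⟩
end

section
/- Let K be a commutative ring, V = K[X], δ : V → V the K-linear formal derivative, M_X multiplication by X, and Γ = M_X ∘ δ. Then for all integers m, n, u, v ≥ 0, as K-linear endomorphisms of V: (Γ^m ∘ δ^u) ∘ (Γ^n ∘ δ^v) = Σ_{t=0}^{n} C(n,t) · u^{n−t} · Γ^{m+t} ∘ δ^{u+v}, where C(n,t) is the binomial coefficient. In particular, the product of two such monomials Γ^m δ^u and Γ^n δ^v is again a ℤ-linear combination of monomials Γ^s δ^{u+v} with 0 ≤ s ≤ m + n, and the top monomial Γ^{m+n} δ^{u+v} occurs with coefficient 1. -/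
open Polynomial

/-- The formal derivative `δ` as a `K`-linear endomorphism of `K[X]`. -/
noncomputable def deltaEnd (K : Type*) [CommRing K] : Module.End K (Polynomial K) :=
  Polynomial.derivative

/-- The Euler operator `Γ = M_X ∘ δ` (multiplication by `X` composed with the formal
derivative) as a `K`-linear endomorphism of `K[X]`. -/
noncomputable def gammaEnd (K : Type*) [CommRing K] : Module.End K (Polynomial K) :=
  (LinearMap.mulLeft K (Polynomial.X : Polynomial K)) * deltaEnd K

/-- The commutation relation `δ Γ = (Γ + 1) δ`. -/
theorem semiconjBy_deltaEnd_gammaEnd (K : Type*) [CommRing K] :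
    SemiconjBy (deltaEnd K) (gammaEnd K) (gammaEnd K + 1) := by
  refine LinearMap.ext fun p => ?_
  simp [deltaEnd, gammaEnd, Module.End.mul_apply, add_comm]

/-- The commutation relation `δ^u Γ = (Γ + u) δ^u`. -/
theorem semiconjBy_deltaEnd_pow_gammaEnd (K : Type*) [CommRing K] (u : ℕ) :
    SemiconjBy (deltaEnd K ^ u) (gammaEnd K) (gammaEnd K + (u : Module.End K K[X])) := by
  induction u with
  | zero => simp
  | succ u ih =>
    have h := ((semiconjBy_deltaEnd_gammaEnd K).add_right
      (Nat.cast_commute u (deltaEnd K)).symm).mul_left ih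
    rwa [← pow_succ', add_right_comm, add_assoc, ← Nat.cast_succ] at h

/-- The product formula
`(Γ^m δ^u) (Γ^n δ^v) = Σ_{t=0}^{n} C(n,t) u^{n−t} Γ^{m+t} δ^{u+v}` as `K`-linear
endomorphisms of `K[X]`; in particular the product is again a `ℤ`-linear combination
of monomials `Γ^s δ^{u+v}` with `0 ≤ s ≤ m+n`, with top monomial `Γ^{m+n} δ^{u+v}`
occurring with coefficient `C(n,n)·u^0 = 1`. -/
theorem gamma_delta_monomial_mul (K : Type*) [CommRing K] (m n u v : ℕ) :
    (gammaEnd K ^ m * deltaEnd K ^ u) * (gammaEnd K ^ n * deltaEnd K ^ v) =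
      ∑ t ∈ Finset.range (n + 1),
        (n.choose t * u ^ (n - t)) • (gammaEnd K ^ (m + t) * deltaEnd K ^ (u + v)) := by
  have h : deltaEnd K ^ u * gammaEnd K ^ n =
      (gammaEnd K + (u : Module.End K K[X])) ^ n * deltaEnd K ^ u :=
    (semiconjBy_deltaEnd_pow_gammaEnd K u).pow_right n
  rw [mul_assoc, ← mul_assoc (deltaEnd K ^ u), h, mul_assoc, ← pow_add,
    (Nat.commute_cast (gammaEnd K) u).add_pow, Finset.sum_mul, Finset.mul_sum]
  refine Finset.sum_congr rfl fun t _ => ?_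
  rw [mul_assoc (gammaEnd K ^ t), ← Nat.cast_pow, ← Nat.cast_mul, ← Nat.cast_comm,
    mul_comm (n.choose t), ← nsmul_eq_mul, smul_mul_assoc, mul_smul_comm, ← mul_assoc, ← pow_add]
end

section
/- Let K be a commutative ring, V = K[X], δ : V → V the K-linear formal derivative, M_X multiplication by X, and Γ = M_X ∘ δ. Then for all integers m, n, u, v ≥ 0, the commutator satisfies, as K-linear endomorphisms of V: [Γ^m ∘ δ^u, Γ^n ∘ δ^v] = Σ_{t=0}^{n−1} C(n,t) · u^{n−t} · Γ^{m+t} ∘ δ^{u+v} − Σ_{t=0}^{m−1} C(m,t) · v^{m−t} · Γ^{n+t} ∘ δ^{u+v}. In particular, the commutator of the monomials Γ^m δ^u and Γ^n δ^v is a ℤ-linear combination of monomials Γ^s δ^{u+v} with 0 ≤ s ≤ m + n − 1: the top term Γ^{m+n} δ^{u+v} cancels. -/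
open Polynomial

theorem deltaEnd_mul_gammaEnd (K : Type*) [CommRing K] :
    deltaEnd K * gammaEnd K = (gammaEnd K + 1) * deltaEnd K := by
  refine LinearMap.ext fun p => ?_
  simp [deltaEnd, gammaEnd, Polynomial.derivative_mul, add_comm]

section Ring

variable {R : Type*} [Ring R] {a d : R}

theorem semiconjBy_pow_add_natCast (h : d * a = (a + 1) * d) (u : ℕ) :
    SemiconjBy (d ^ u) a (a + u) := by
  induction u with
  | zero => simp
  | succ u ih =>
    have hd : SemiconjBy d (a + u) (a + 1 + u) :=
      SemiconjBy.add_right h (Nat.cast_commute u d).symm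
    rw [pow_succ', Nat.cast_succ, add_comm (u : R) 1, ← add_assoc]
    exact hd.mul_left ih

theorem monomial_mul_monomial_eq_sum (h : d * a = (a + 1) * d) (m n u v : ℕ) :
    (a ^ m * d ^ u) * (a ^ n * d ^ v) =
      (∑ t ∈ Finset.range n, (n.choose t * u ^ (n - t)) • (a ^ (m + t) * d ^ (u + v)))
        + a ^ (m + n) * d ^ (u + v) := by
  have hpow : d ^ u * a ^ n = (a + u) ^ n * d ^ u :=
    (semiconjBy_pow_add_natCast h u).pow_right n
  calc (a ^ m * d ^ u) * (a ^ n * d ^ v) = a ^ m * (d ^ u * a ^ n) * d ^ v := by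
        simp only [mul_assoc]
    _ = a ^ m * (a + u) ^ n * d ^ (u + v) := by
        rw [hpow, pow_add]; simp only [mul_assoc]
    _ = ∑ t ∈ Finset.range (n + 1),
          (n.choose t * u ^ (n - t)) • (a ^ (m + t) * d ^ (u + v)) := by
        rw [(Nat.cast_commute u a).symm.add_pow, Finset.mul_sum, Finset.sum_mul]
        refine Finset.sum_congr rfl fun t _ => ?_
        rw [mul_assoc (a ^ t), ← Nat.cast_pow, ← Nat.cast_mul, ← mul_assoc, ← pow_add,
          ← Nat.cast_comm, mul_assoc, ← nsmul_eq_mul, mul_comm (u ^ (n - t))]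
    _ = _ := by simp [Finset.sum_range_succ]

end Ring

/-- The commutator formula
`[Γ^m δ^u, Γ^n δ^v] = Σ_{t=0}^{n−1} C(n,t) u^{n−t} Γ^{m+t} δ^{u+v}
  − Σ_{t=0}^{m−1} C(m,t) v^{m−t} Γ^{n+t} δ^{u+v}`
as `K`-linear endomorphisms of `K[X]`; in particular the commutator is a `ℤ`-linear
combination of monomials `Γ^s δ^{u+v}` with `0 ≤ s ≤ m+n−1`: the top term
`Γ^{m+n} δ^{u+v}` cancels. -/
theorem gamma_delta_monomial_commutator (K : Type*) [CommRing K] (m n u v : ℕ) :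
    (gammaEnd K ^ m * deltaEnd K ^ u) * (gammaEnd K ^ n * deltaEnd K ^ v)
        - (gammaEnd K ^ n * deltaEnd K ^ v) * (gammaEnd K ^ m * deltaEnd K ^ u) =
      (∑ t ∈ Finset.range n,
        (n.choose t * u ^ (n - t)) • (gammaEnd K ^ (m + t) * deltaEnd K ^ (u + v)))
      - (∑ t ∈ Finset.range m,
        (m.choose t * v ^ (m - t)) • (gammaEnd K ^ (n + t) * deltaEnd K ^ (u + v))) := by
  have h := deltaEnd_mul_gammaEnd K
  rw [monomial_mul_monomial_eq_sum h m n u v, monomial_mul_monomial_eq_sum h n m v u,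
    add_comm n m, add_comm v u]
  abel
end
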